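/- Let C be a self-dual Z_2R linear code in Z_2^α × R^β (so α is even). Then the following are equivalent: (1) C is separable; (2) C_X is a self-orthogonal binary code (C_X is contained in its orthogonal complement in Z_2^α for the standard dot product); (3) C_X is a self-dual binary code; (4) |C_X| = 2^{α/2}; (5) C_Y is self-orthogonal in R^β with respect to the R-bilinear form ⟨y,w⟩_R = Σ_{j=1}^β y_j w_j; (6) C_Y is self-dual in R^β with respect to that form; (7) |C_Y| = 2^β. -/

import Mathlib

open Finset

namespace Z2R

abbrev Rng : Type := DualNumber (ZMod 2)
noncomputable instance : DecidableEq Rng := Classical.decEq _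
def uu : Rng := DualNumber.eps
abbrev Amb (α β : ℕ) : Type := (Fin α → ZMod 2) × (Fin β → Rng)
def smulR {α β : ℕ} (d : Rng) (x : Amb α β) : Amb α β :=
  (fun i => d.fst * x.1 i, fun j => d * x.2 j)
def IsCode {α β : ℕ} (C : Set (Amb α β)) : Prop :=
  (0 : Amb α β) ∈ C ∧ (∀ x ∈ C, ∀ y ∈ C, x + y ∈ C) ∧ ∀ (d : Rng), ∀ x ∈ C, smulR d x ∈ C
def inn {α β : ℕ} (v w : Amb α β) : Rng :=
  TrivSqZeroExt.inr (∑ i, v.1 i * w.1 i) + ∑ j, v.2 j * w.2 j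
def dual {α β : ℕ} (C : Set (Amb α β)) : Set (Amb α β) :=
  {w | ∀ v ∈ C, inn v w = 0}
def IsSelfDual {α β : ℕ} (C : Set (Amb α β)) : Prop :=
  IsCode C ∧ C = dual C
def wtH {n : ℕ} (v : Fin n → ZMod 2) : ℕ := (univ.filter fun i => v i ≠ 0).card
noncomputable def wtLr (r : Rng) : ℕ := if r = 0 then 0 else if r = uu then 2 else 1
noncomputable def wtL {α β : ℕ} (c : Amb α β) : ℕ := wtH c.1 + ∑ j, wtLr (c.2 j)
noncomputable def N {β : ℕ} (w : Fin β → Rng) : ℕ :=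
  (univ.filter fun j => w j = 1 ∨ w j = 1 + uu).card
noncomputable def Nu {β : ℕ} (w : Fin β → Rng) : ℕ :=
  (univ.filter fun j => w j = uu).card
noncomputable def Ns {β : ℕ} (w y : Fin β → Rng) : ℕ :=
  (univ.filter fun j => w j = y j ∧ (w j = 1 ∨ w j = 1 + uu)).card
noncomputable def Nd {β : ℕ} (w y : Fin β → Rng) : ℕ :=
  (univ.filter fun j => (w j = 1 ∧ y j = 1 + uu) ∨ (w j = 1 + uu ∧ y j = 1)).card
noncomputable def N11 {β : ℕ} (w y : Fin β → Rng) : ℕ :=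
  (univ.filter fun j => (w j = 1 ∨ w j = 1 + uu) ∧ (y j = 1 ∨ y j = 1 + uu)).card
def CX {α β : ℕ} (C : Set (Amb α β)) : Set (Fin α → ZMod 2) := Prod.fst '' C
def CY {α β : ℕ} (C : Set (Amb α β)) : Set (Fin β → Rng) := Prod.snd '' C
def Separable {α β : ℕ} (C : Set (Amb α β)) : Prop := C = (CX C) ×ˢ (CY C)
def Cb {α β : ℕ} (C : Set (Amb α β)) : Set (Amb α β) :=
  {c ∈ C | ∀ j, c.2 j = 0 ∨ c.2 j = uu}
def lincomb {α β k : ℕ} (g : Fin k → Amb α β) : Set (Amb α β) :=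
  {z | ∃ a : Fin k → Rng, z = ∑ i, smulR (a i) (g i)}
noncomputable def theta (r : Rng) : ZMod 4 :=
  if r = 0 then 0 else if r = 1 then 1 else if r = uu then 2 else 3

theorem natCard_eq_two_pow_iff_eq_orthogonal {V : Type*} [AddCommGroup V] [Module (ZMod 2) V]
    [FiniteDimensional (ZMod 2) V] {B : LinearMap.BilinForm (ZMod 2) V} (hB : B.Nondegenerate)
    {W : Submodule (ZMod 2) V} (hW : B.orthogonal W ≤ W) :
    W = B.orthogonal W ↔ Nat.card W = 2 ^ (Module.finrank (ZMod 2) V / 2) := by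
  have hperp := LinearMap.BilinForm.finrank_orthogonal hB W
  have hle := Submodule.finrank_le W
  rw [Module.natCard_eq_pow_finrank (K := ZMod 2), Nat.card_zmod,
    (Nat.pow_right_injective le_rfl).eq_iff]
  constructor
  · intro h
    rw [← h] at hperp
    omega
  · intro h
    exact (Submodule.eq_of_le_of_finrank_le hW (by omega)).symm

section Bilinear

variable {α β : ℕ}

def dotForm (α : ℕ) : LinearMap.BilinForm (ZMod 2) (Fin α → ZMod 2) :=
  dotProductBilin (ZMod 2) (ZMod 2)

theorem dotForm_apply (x y : Fin α → ZMod 2) : dotForm α x y = ∑ i, x i * y i := rfl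

theorem dotForm_nondegenerate : (dotForm α).Nondegenerate := by
  refine ⟨fun x hx => ?_, fun y hy => ?_⟩
  · funext i
    simpa [dotForm_apply, Pi.single_apply] using hx (Pi.single i 1)
  · funext i
    simpa [dotForm_apply, Pi.single_apply] using hy (Pi.single i 1)

/-- The `u`-coefficient of the `R`-valued dot product on `R ^ β`. -/
def epsForm (β : ℕ) : LinearMap.BilinForm (ZMod 2) (Fin β → Rng) :=
  LinearMap.mk₂ (ZMod 2) (fun y w => (∑ j, y j * w j).snd)
    (fun y y' w => by simp only [Pi.add_apply, add_mul, sum_add_distrib, TrivSqZeroExt.snd_add])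
    (fun c y w => by
      simp only [Pi.smul_apply, smul_mul_assoc, ← smul_sum, TrivSqZeroExt.snd_smul])
    (fun y w w' => by simp only [Pi.add_apply, mul_add, sum_add_distrib, TrivSqZeroExt.snd_add])
    (fun c y w => by
      simp only [Pi.smul_apply, mul_smul_comm, ← smul_sum, TrivSqZeroExt.snd_smul])

theorem epsForm_apply (y w : Fin β → Rng) : epsForm β y w = (∑ j, y j * w j).snd := rfl

theorem epsForm_comm (y w : Fin β → Rng) : epsForm β y w = epsForm β w y := by
  simp only [epsForm_apply, mul_comm]

theorem eq_zero_of_forall_snd_mul_eq_zero {r : Rng} (h : ∀ d : Rng, (d * r).snd = 0) :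
    r = 0 := by
  refine TrivSqZeroExt.ext ?_ ?_
  · simpa using h DualNumber.eps
  · simpa using h 1

theorem epsForm_nondegenerate : (epsForm β).Nondegenerate := by
  have key : ∀ w : Fin β → Rng, (∀ y, epsForm β y w = 0) → w = 0 := by
    intro w hw
    funext j
    refine eq_zero_of_forall_snd_mul_eq_zero fun d => ?_
    have h := hw (Pi.single j d)
    rwa [epsForm_apply, sum_eq_single j (fun i _ hi => by simp [hi]) (by simp),
      Pi.single_eq_same] at h
  exact ⟨fun y hy => key y fun w => (epsForm_comm w y).trans (hy w), fun w hw => key w hw⟩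

instance : FiniteDimensional (ZMod 2) Rng :=
  inferInstanceAs (FiniteDimensional (ZMod 2) (ZMod 2 × ZMod 2))

theorem finrank_rng : Module.finrank (ZMod 2) Rng = 2 := by
  change Module.finrank (ZMod 2) (ZMod 2 × ZMod 2) = 2
  simp

end Bilinear

section Code

variable {α β : ℕ} {C : Set (Amb α β)}

theorem IsCode.sub_mem (hC : IsCode C) {v w : Amb α β} (hv : v ∈ C) (hw : w ∈ C) : v - w ∈ C := by
  convert hC.2.1 v hv _ (hC.2.2 (-1) w hw) using 1
  ext <;> simp [smulR, sub_eq_add_neg]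

theorem IsCode.exists_submodule_CX (hC : IsCode C) :
    ∃ W : Submodule (ZMod 2) (Fin α → ZMod 2), (W : Set (Fin α → ZMod 2)) = CX C :=
  ⟨{ carrier := CX C
     zero_mem' := ⟨0, hC.1, rfl⟩
     add_mem' := by
      rintro _ _ ⟨v, hv, rfl⟩ ⟨w, hw, rfl⟩
      exact ⟨v + w, hC.2.1 v hv w hw, rfl⟩
     smul_mem' := by
      rintro c _ ⟨v, hv, rfl⟩
      exact ⟨_, hC.2.2 (TrivSqZeroExt.inl c) v hv, rfl⟩ }, rfl⟩

theorem IsCode.exists_submodule_CY (hC : IsCode C) :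
    ∃ W : Submodule Rng (Fin β → Rng), (W : Set (Fin β → Rng)) = CY C :=
  ⟨{ carrier := CY C
     zero_mem' := ⟨0, hC.1, rfl⟩
     add_mem' := by
      rintro _ _ ⟨v, hv, rfl⟩ ⟨w, hw, rfl⟩
      exact ⟨v + w, hC.2.1 v hv w hw, rfl⟩
     smul_mem' := by
      rintro c _ ⟨v, hv, rfl⟩
      exact ⟨_, hC.2.2 c v hv, rfl⟩ }, rfl⟩

theorem mem_epsForm_orthogonal_iff {W : Submodule Rng (Fin β → Rng)} {w : Fin β → Rng} :
    w ∈ (epsForm β).orthogonal (W.restrictScalars (ZMod 2)) ↔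
      ∀ y ∈ W, ∑ j, y j * w j = 0 := by
  rw [LinearMap.BilinForm.mem_orthogonal_iff]
  refine ⟨fun h y hy => eq_zero_of_forall_snd_mul_eq_zero fun d => ?_, fun h y hy => ?_⟩
  · have := h (d • y) (W.smul_mem d hy)
    simpa only [epsForm_apply, Pi.smul_apply, smul_eq_mul,
      mul_assoc, ← mul_sum] using this
  · rw [epsForm_apply, h y hy, TrivSqZeroExt.snd_zero]

theorem IsSelfDual.mk_zero_mem_iff (hC : IsSelfDual C) {x : Fin α → ZMod 2} :
    (x, 0) ∈ C ↔ ∀ x' ∈ CX C, ∑ i, x' i * x i = 0 := by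
  conv_lhs => rw [hC.2]
  have h : ∀ v : Amb α β, inn v (x, 0) = 0 ↔ ∑ i, v.1 i * x i = 0 := fun v => by
    simpa [inn] using (TrivSqZeroExt.inr_injective (R := ZMod 2) (M := ZMod 2)).eq_iff
      (a := ∑ i, v.1 i * x i) (b := 0)
  simp only [dual, Set.mem_ofPred_eq, h, CX, Set.forall_mem_image]

theorem IsSelfDual.zero_mk_mem_iff (hC : IsSelfDual C) {y : Fin β → Rng} :
    (0, y) ∈ C ↔ ∀ y' ∈ CY C, ∑ j, y' j * y j = 0 := by
  conv_lhs => rw [hC.2]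
  have h : ∀ v : Amb α β, inn v (0, y) = ∑ j, v.2 j * y j := fun v => by simp [inn]
  simp only [dual, Set.mem_ofPred_eq, h, CY, Set.forall_mem_image]

theorem IsCode.separable_iff_forall_mk_zero_mem (hC : IsCode C) :
    Separable C ↔ ∀ x ∈ CX C, (x, 0) ∈ C := by
  constructor
  · intro h x hx
    rw [h]
    exact ⟨hx, 0, hC.1, rfl⟩
  · intro h
    refine Set.Subset.antisymm (fun v hv => ⟨⟨v, hv, rfl⟩, v, hv, rfl⟩) ?_
    rintro ⟨x, y⟩ ⟨hx, ⟨x', y⟩, hv, rfl⟩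
    have := hC.2.1 _ (hC.sub_mem hv (h x' ⟨_, hv, rfl⟩)) _ (h x hx)
    simpa using this

theorem IsCode.separable_iff_forall_zero_mk_mem (hC : IsCode C) :
    Separable C ↔ ∀ y ∈ CY C, (0, y) ∈ C := by
  rw [hC.separable_iff_forall_mk_zero_mem]
  constructor
  · rintro h _ ⟨v, hv, rfl⟩
    simpa [Prod.sub_def] using hC.sub_mem hv (h v.1 ⟨v, hv, rfl⟩)
  · rintro h _ ⟨v, hv, rfl⟩
    simpa [Prod.sub_def] using hC.sub_mem hv (h v.2 ⟨v, hv, rfl⟩)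

theorem IsSelfDual.dual_CX_subset (hC : IsSelfDual C) :
    {y | ∀ x ∈ CX C, ∑ i, x i * y i = 0} ⊆ CX C :=
  fun x hx => ⟨(x, 0), hC.mk_zero_mem_iff.2 hx, rfl⟩

theorem IsSelfDual.dual_CY_subset (hC : IsSelfDual C) :
    {w | ∀ y ∈ CY C, ∑ j, y j * w j = 0} ⊆ CY C :=
  fun y hy => ⟨(0, y), hC.zero_mk_mem_iff.2 hy, rfl⟩

theorem IsSelfDual.CX_eq_dual_iff_natCard (hC : IsSelfDual C) :
    CX C = {y | ∀ x ∈ CX C, ∑ i, x i * y i = 0} ↔ Nat.card (CX C) = 2 ^ (α / 2) := by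
  obtain ⟨W, hW⟩ := hC.1.exists_submodule_CX
  have hsub := hC.dual_CX_subset
  rw [← hW] at hsub ⊢
  have horth : {y | ∀ x ∈ (W : Set (Fin α → ZMod 2)), ∑ i, x i * y i = 0} =
      ((dotForm α).orthogonal W : Set (Fin α → ZMod 2)) := rfl
  rw [horth] at hsub ⊢
  simpa using natCard_eq_two_pow_iff_eq_orthogonal dotForm_nondegenerate hsub

theorem IsSelfDual.CY_eq_dual_iff_natCard (hC : IsSelfDual C) :
    CY C = {w | ∀ y ∈ CY C, ∑ j, y j * w j = 0} ↔ Nat.card (CY C) = 2 ^ β := by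
  obtain ⟨W, hW⟩ := hC.1.exists_submodule_CY
  have hsub := hC.dual_CY_subset
  rw [← hW] at hsub ⊢
  have horth : {w | ∀ y ∈ (W : Set (Fin β → Rng)), ∑ j, y j * w j = 0} =
      ((epsForm β).orthogonal (W.restrictScalars (ZMod 2)) : Set (Fin β → Rng)) :=
    Set.ext fun _ => mem_epsForm_orthogonal_iff.symm
  rw [horth] at hsub ⊢
  have hrank : Module.finrank (ZMod 2) (Fin β → Rng) / 2 = β := by
    rw [Module.finrank_pi_fintype]
    simp [finrank_rng]
  have h := natCard_eq_two_pow_iff_eq_orthogonal epsForm_nondegenerate hsub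
  rw [hrank, ← SetLike.coe_set_eq] at h
  exact h

end Code

-- STATEMENT 5
theorem stmt5 {α β : ℕ} (C : Set (Amb α β)) (hC : IsSelfDual C) :
    List.TFAE [Separable C,
      ∀ x ∈ CX C, ∀ y ∈ CX C, ∑ i, x i * y i = 0,
      CX C = {y | ∀ x ∈ CX C, ∑ i, x i * y i = 0},
      Nat.card (CX C) = 2 ^ (α / 2),
      ∀ y ∈ CY C, ∀ w ∈ CY C, ∑ j, y j * w j = 0,
      CY C = {w | ∀ y ∈ CY C, ∑ j, y j * w j = 0},
      Nat.card (CY C) = 2 ^ β] := by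
  have h12 : Separable C ↔ ∀ x ∈ CX C, ∀ y ∈ CX C, ∑ i, x i * y i = 0 := by
    rw [hC.1.separable_iff_forall_mk_zero_mem]
    simp only [hC.mk_zero_mem_iff]
    exact forall₂_comm
  have h15 : Separable C ↔ ∀ y ∈ CY C, ∀ w ∈ CY C, ∑ j, y j * w j = 0 := by
    rw [hC.1.separable_iff_forall_zero_mk_mem]
    simp only [hC.zero_mk_mem_iff]
    exact forall₂_comm
  tfae_have 1 ↔ 2 := h12
  tfae_have 2 → 3 := fun h =>
    Set.Subset.antisymm (fun y hy x hx => h x hx y hy) hC.dual_CX_subset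
  tfae_have 3 → 2 := fun h x hx y hy => h.subset hy x hx
  tfae_have 3 ↔ 4 := hC.CX_eq_dual_iff_natCard
  tfae_have 1 ↔ 5 := h15
  tfae_have 5 → 6 := fun h =>
    Set.Subset.antisymm (fun w hw y hy => h y hy w hw) hC.dual_CY_subset
  tfae_have 6 → 5 := fun h y hy w hw => h.subset hw y hy
  tfae_have 6 ↔ 7 := hC.CY_eq_dual_iff_natCard
  tfae_finish

end Z2R
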